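/- Let p be an odd prime, f : ℤ_p → ℤ_p continuous, s ∈ ℤ_p, and y ∈ ℚ_p with ‖y‖_p > 1. Then there exists a sequence (c_n) in ℚ_p such that for every λ ∈ ℚ_p with ‖λ−y‖_p < ‖y‖_p, the fermionic integral ζ_{p,E}^f(s,λ) exists, the series Σ_{n=0}^∞ c_n (λ−y)^n converges, and ζ_{p,E}^f(s,λ) = Σ_{n=0}^∞ c_n (λ−y)^n; that is, λ ↦ ζ_{p,E}^f(s,λ) is analytic on the disc ‖λ−y‖_p < ‖y‖_p. -/

import Mathlib

open Filter Topology

namespace PZeta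

variable (p : ℕ) [Fact p.Prime]

/-- The `N`-th partial sum defining the fermionic integral
`∫_{ℤ_p} g dμ₋₁ = lim_N Σ_{a=0}^{p^N-1} (-1)^a g(a)`. -/
noncomputable def fermSum (g : ℤ_[p] → ℚ_[p]) (N : ℕ) : ℚ_[p] :=
  ∑ a ∈ Finset.range (p ^ N), (-1 : ℚ_[p]) ^ a * g (a : ℤ_[p])

/-- The `N`-th partial sum defining the Volkenborn integral
`∫_{ℤ_p} g da = lim_N p^{-N} Σ_{a=0}^{p^N-1} g(a)`. -/
noncomputable def volkSum (g : ℤ_[p] → ℚ_[p]) (N : ℕ) : ℚ_[p] :=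
  ((p : ℚ_[p]) ^ N)⁻¹ * ∑ a ∈ Finset.range (p ^ N), g (a : ℤ_[p])

/-- The unit part `x·p^{-v_p(x)}` of a nonzero `p`-adic number. -/
noncomputable def unitPart (x : ℚ_[p]) : ℚ_[p] := x * (p : ℚ_[p]) ^ (-x.valuation)

/-- The Teichmüller representative of a `p`-adic unit, `lim_n x^{p^n}`. -/
noncomputable def teich (x : ℚ_[p]) : ℚ_[p] :=
  limUnder atTop fun n : ℕ => x ^ p ^ n

/-- The projection `⟨x⟩ ∈ 1 + pℤ_p`, via `x = p^{v_p(x)}·ζ·⟨x⟩`. -/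
noncomputable def angle (x : ℚ_[p]) : ℚ_[p] := unitPart p x / teich p (unitPart p x)

/-- `ω_v(x) := x / ⟨x⟩ = p^{v_p(x)}·ζ`. -/
noncomputable def omegaV (x : ℚ_[p]) : ℚ_[p] := x / angle p x

/-- The generalized binomial coefficient `C(t,n) = t(t-1)⋯(t-n+1)/n!`. -/
noncomputable def gbinom (t : ℚ_[p]) (n : ℕ) : ℚ_[p] :=
  (∏ i ∈ Finset.range n, (t - (i : ℚ_[p]))) / (n.factorial : ℚ_[p])

/-- The power `y^t` defined by the binomial series `Σ_n C(t,n)(y-1)^n`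
(used for `y ∈ 1 + pℤ_p` and `t ∈ ℤ_p`). -/
noncomputable def bpow (y t : ℚ_[p]) : ℚ_[p] := ∑' n : ℕ, gbinom p t n * (y - 1) ^ n

/-- The Iwasawa `p`-adic logarithm: `log_p x = Σ_{n≥1} (-1)^{n+1}(⟨x⟩-1)^n/n`
(one has `log_p p = 0` and `log_p ζ = 0` for roots of unity of order prime to `p`). -/
noncomputable def padicLog (x : ℚ_[p]) : ℚ_[p] :=
  ∑' n : ℕ, (-1 : ℚ_[p]) ^ n * (angle p x - 1) ^ (n + 1) / ((n : ℚ_[p]) + 1)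

/-- The power `y^t` defined by the exponential series `Σ_n (t·log_p y)^n/n!`
(used for `y ∈ 1 + pℤ_p` and `‖t‖ < p^{(p-2)/(p-1)}`). -/
noncomputable def epow (y t : ℚ_[p]) : ℚ_[p] :=
  ∑' n : ℕ, (t * padicLog p y) ^ n / (n.factorial : ℚ_[p])

/-- `f : ℤ_p → ℤ_p` is everywhere analytic with integral coefficients:
`f(x) = Σ_k c_k x^k` with `‖c_k‖ ≤ 1`, `c_k → 0`. -/
def EverywhereAnalytic (f : ℤ_[p] → ℤ_[p]) : Prop :=
  ∃ c : ℕ → ℚ_[p], (∀ k, ‖c k‖ ≤ 1) ∧ Tendsto c atTop (𝓝 0) ∧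
    ∀ x : ℤ_[p], (f x : ℚ_[p]) = ∑' k : ℕ, c k * (x : ℚ_[p]) ^ k

/-- The `p`-adic Hurwitz-type Euler zeta function w.r.t. `f`:
`ζ_{p,E}^f(s,λ) = ∫_{ℤ_p} ⟨λ+f(a)⟩^{1-s} dμ₋₁(a)`. -/
noncomputable def zetaE (f : ℤ_[p] → ℤ_[p]) (s : ℤ_[p]) (lam : ℚ_[p]) : ℚ_[p] :=
  limUnder atTop
    (fermSum p fun a => bpow p (angle p (lam + (f a : ℚ_[p]))) (1 - (s : ℚ_[p])))

/-- The `p`-adic Hurwitz zeta function w.r.t. `f`: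
`ζ_p^f(s,λ) = (s-1)⁻¹ ∫_{ℤ_p} ⟨λ+f(a)⟩^{1-s} da`. -/
noncomputable def zetaH (f : ℤ_[p] → ℤ_[p]) (s : ℤ_[p]) (lam : ℚ_[p]) : ℚ_[p] :=
  ((s : ℚ_[p]) - 1)⁻¹ *
    limUnder atTop
      (volkSum p fun a => bpow p (angle p (lam + (f a : ℚ_[p]))) (1 - (s : ℚ_[p])))

end PZeta

namespace PZeta

variable {p : ℕ} [Fact p.Prime]

theorem tendsto_pow_prime_pow_of_norm_sub_one_lt {v : ℤ_[p]} (hv : ‖v - 1‖ < 1) :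
    Tendsto (fun n : ℕ => v ^ p ^ n) atTop (𝓝 1) := by
  have hp1 : (p : ℝ)⁻¹ < 1 := inv_lt_one_of_one_lt₀ (mod_cast (Fact.out : p.Prime).one_lt)
  rw [tendsto_iff_norm_sub_tendsto_zero]
  refine squeeze_zero (fun _ => norm_nonneg _) (fun n => ?_)
    ((tendsto_pow_atTop_nhds_zero_of_lt_one (by positivity) hp1).comp (tendsto_add_atTop_nat 1))
  have h := dvd_sub_pow_of_dvd_sub ((PadicInt.norm_lt_one_iff_dvd _).1 hv) n
  rw [one_pow, ← Ideal.mem_span_singleton, ← PadicInt.norm_le_pow_iff_mem_span_pow, zpow_neg,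
    zpow_natCast] at h
  simpa [inv_pow] using h

theorem exists_tendsto_pow_prime_pow {u : ℤ_[p]} (hu : ‖u‖ = 1) :
    ∃ T : ℤ_[p], Tendsto (fun n : ℕ => u ^ p ^ n) atTop (𝓝 T) ∧ ‖T‖ = 1 ∧ ‖u - T‖ < 1 := by
  have hp1 : (p : ℝ)⁻¹ < 1 := inv_lt_one_of_one_lt₀ (mod_cast (Fact.out : p.Prime).one_lt)
  have dvd_of_toZMod (w : ℤ_[p]) (hw : PadicInt.toZMod w = 0) : (p : ℤ_[p]) ∣ w := by
    rwa [← RingHom.mem_ker, PadicInt.ker_toZMod, PadicInt.maximalIdeal_eq_span_p,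
      Ideal.mem_span_singleton] at hw
  have hstep (n : ℕ) : dist (u ^ p ^ n) (u ^ p ^ (n + 1)) ≤ (p : ℝ)⁻¹ * (p : ℝ)⁻¹ ^ n := by
    have h := dvd_sub_pow_of_dvd_sub (dvd_of_toZMod (u - u ^ p) (by simp)) n
    rw [← Ideal.mem_span_singleton, ← PadicInt.norm_le_pow_iff_mem_span_pow, zpow_neg,
      zpow_natCast] at h
    rwa [dist_eq_norm, pow_succ' p n, pow_mul u, ← pow_succ', inv_pow]
  obtain ⟨T, hT⟩ := cauchySeq_tendsto_of_complete (cauchySeq_of_le_geometric _ _ hp1 hstep)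
  refine ⟨T, hT, ?_, ?_⟩
  · exact tendsto_nhds_unique hT.norm (by simp [hu])
  · refine lt_of_le_of_lt (le_of_tendsto (tendsto_const_nhds.sub hT).norm
      (Eventually.of_forall fun n => ?_)) hp1
    have h := dvd_of_toZMod (u - u ^ p ^ n) (by simp [ZMod.pow_card_pow])
    rw [← pow_one (p : ℤ_[p]), ← Ideal.mem_span_singleton,
      ← PadicInt.norm_le_pow_iff_mem_span_pow] at h
    simpa using h

theorem norm_unitPart {x : ℚ_[p]} (hx : x ≠ 0) : ‖unitPart p x‖ = 1 := by
  have hp0 : (p : ℝ) ≠ 0 := mod_cast (Fact.out : p.Prime).ne_zero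
  rw [unitPart, norm_mul, norm_zpow, Padic.norm_p, Padic.norm_eq_zpow_neg_valuation hx,
    inv_zpow', neg_neg, ← zpow_add₀ hp0, neg_add_cancel, zpow_zero]

theorem ne_zero_of_norm_sub_one_lt {v : ℚ_[p]} (hv : ‖v - 1‖ < 1) : v ≠ 0 := by
  rintro rfl
  simp at hv

theorem norm_eq_one_of_norm_sub_one_lt {v : ℚ_[p]} (hv : ‖v - 1‖ < 1) : ‖v‖ = 1 := by
  simpa using IsUltrametricDist.norm_add_eq_max_of_norm_ne_norm (x := v - 1) (y := 1)
    (by simpa using hv.ne) |>.trans (by simp [hv.le])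

theorem unitPart_mul_of_norm_sub_one_lt {x v : ℚ_[p]} (hx : x ≠ 0) (hv : ‖v - 1‖ < 1) :
    unitPart p (x * v) = unitPart p x * v := by
  have hv0 := ne_zero_of_norm_sub_one_lt hv
  have hval : v.valuation = 0 := by
    have h := norm_eq_one_of_norm_sub_one_lt hv
    rw [Padic.norm_eq_zpow_neg_valuation hv0,
      zpow_eq_one_iff_right₀ (by positivity) (mod_cast (Fact.out : p.Prime).ne_one)] at h
    simpa using h
  rw [unitPart, unitPart, Padic.valuation_mul hx hv0, hval, add_zero]
  ring

theorem tendsto_padicInt_coe {w : ℕ → ℤ_[p]} {z : ℤ_[p]} (h : Tendsto w atTop (𝓝 z)) :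
    Tendsto (fun n => (w n : ℚ_[p])) atTop (𝓝 (z : ℚ_[p])) :=
  (continuous_subtype_val.tendsto z).comp h

theorem tendsto_teich {u : ℚ_[p]} (hu : ‖u‖ = 1) :
    Tendsto (fun n : ℕ => u ^ p ^ n) atTop (𝓝 (teich p u)) ∧ ‖teich p u‖ = 1 ∧
      ‖u - teich p u‖ < 1 := by
  obtain ⟨u, rfl⟩ : ∃ w : ℤ_[p], (w : ℚ_[p]) = u := ⟨⟨u, hu.le⟩, rfl⟩
  obtain ⟨T, hT, hT1, huT⟩ := exists_tendsto_pow_prime_pow (u := u) (by simpa using hu)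
  have h : Tendsto (fun n : ℕ => (u : ℚ_[p]) ^ p ^ n) atTop (𝓝 (T : ℚ_[p])) := by
    simpa using tendsto_padicInt_coe hT
  rw [teich, h.limUnder_eq]
  exact ⟨h, by simpa using hT1, huT⟩

theorem teich_mul_of_norm_sub_one_lt {u v : ℚ_[p]} (hu : ‖u‖ = 1) (hv : ‖v - 1‖ < 1) :
    teich p (u * v) = teich p u := by
  refine Tendsto.limUnder_eq ?_
  have hv1 := (norm_eq_one_of_norm_sub_one_lt hv).le
  obtain ⟨v, rfl⟩ : ∃ w : ℤ_[p], (w : ℚ_[p]) = v := ⟨⟨v, hv1⟩, rfl⟩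
  have h : Tendsto (fun n : ℕ => (v : ℚ_[p]) ^ p ^ n) atTop (𝓝 1) := by
    simpa using tendsto_padicInt_coe
      (tendsto_pow_prime_pow_of_norm_sub_one_lt (v := v) (by simpa [PadicInt.norm_def] using hv))
  simpa [mul_pow] using (tendsto_teich hu).1.mul h

theorem norm_angle_sub_one_lt {x : ℚ_[p]} (hx : x ≠ 0) : ‖angle p x - 1‖ < 1 := by
  obtain ⟨-, hT, h⟩ := tendsto_teich (norm_unitPart hx)
  have hT0 : teich p (unitPart p x) ≠ 0 := norm_ne_zero_iff.1 (by simp [hT])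
  rwa [angle, div_sub_one hT0, norm_div, hT, div_one]

theorem angle_mul_of_norm_sub_one_lt {x v : ℚ_[p]} (hx : x ≠ 0) (hv : ‖v - 1‖ < 1) :
    angle p (x * v) = angle p x * v := by
  rw [angle, angle, unitPart_mul_of_norm_sub_one_lt hx hv,
    teich_mul_of_norm_sub_one_lt (norm_unitPart hx) hv]
  ring

theorem gbinom_eq_choose (t : ℤ_[p]) (n : ℕ) :
    gbinom p (t : ℚ_[p]) n = (Ring.choose t n : ℤ_[p]) := by
  have h := Ring.descPochhammer_eq_factorial_smul_choose t n
  have h2 : (descPochhammer ℤ n).smeval t = ∏ i ∈ Finset.range n, (t - (i : ℤ_[p])) := by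
    rw [← Polynomial.aeval_eq_smeval, Polynomial.aeval_def, Polynomial.eval₂_eq_eval_map,
      descPochhammer_map, descPochhammer_eval_eq_prod_range]
  rw [h2] at h
  rw [gbinom, div_eq_iff (mod_cast n.factorial_ne_zero), mul_comm]
  have h3 := congrArg PadicInt.Coe.ringHom h
  simp only [map_prod, map_sub, map_natCast, nsmul_eq_mul] at h3
  exact h3

theorem norm_gbinom_le_one (t : ℤ_[p]) (n : ℕ) : ‖gbinom p (t : ℚ_[p]) n‖ ≤ 1 := by
  rw [gbinom_eq_choose]
  exact PadicInt.norm_le_one _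

instance : IsBoundedSMul ℤ_[p] ℚ_[p] :=
  .of_norm_smul_le fun r x => by rw [Algebra.smul_def, norm_mul]; rfl

theorem exists_continuousMap_eq_bpow {v : ℚ_[p]} (hv : ‖v - 1‖ < 1) :
    ∃ F : C(ℤ_[p], ℚ_[p]), (∀ t : ℤ_[p], bpow p v (t : ℚ_[p]) = F t) ∧ ∀ n : ℕ, F n = v ^ n := by
  have hr := tendsto_pow_atTop_nhds_zero_iff_norm_lt_one.2 hv
  refine ⟨PadicInt.mahlerSeries ((v - 1) ^ ·), fun t => ?_, fun n => ?_⟩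
  · rw [PadicInt.mahlerSeries_apply hr, bpow]
    refine tsum_congr fun n => ?_
    rw [gbinom_eq_choose, mahler_apply, Algebra.smul_def]
    rfl
  · rw [PadicInt.mahlerSeries_apply_nat hr le_rfl]
    conv_rhs => rw [← sub_add_cancel v 1, add_pow]
    simp [mul_comm]

theorem bpow_mul {u v : ℚ_[p]} (hu : ‖u - 1‖ < 1) (hv : ‖v - 1‖ < 1) (t : ℤ_[p]) :
    bpow p (u * v) (t : ℚ_[p]) = bpow p u (t : ℚ_[p]) * bpow p v (t : ℚ_[p]) := by
  have huv : ‖u * v - 1‖ < 1 := by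
    rw [show u * v - 1 = (u - 1) * v + (v - 1) by ring]
    refine (IsUltrametricDist.norm_add_le_max _ _).trans_lt (max_lt ?_ hv)
    rwa [norm_mul, norm_eq_one_of_norm_sub_one_lt hv, mul_one]
  obtain ⟨F, hF, hFn⟩ := exists_continuousMap_eq_bpow hu
  obtain ⟨G, hG, hGn⟩ := exists_continuousMap_eq_bpow hv
  obtain ⟨H, hH, hHn⟩ := exists_continuousMap_eq_bpow huv
  rw [hF, hG, hH]
  refine congrFun (PadicInt.denseRange_natCast.equalizer (map_continuous H)
    ((map_continuous F).mul (map_continuous G)) (funext fun n => ?_)) t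
  simp [hFn, hGn, hHn, mul_pow]

theorem norm_bpow_sub_one_le {v : ℚ_[p]} (hv : ‖v - 1‖ < 1) (t : ℤ_[p]) :
    ‖bpow p v (t : ℚ_[p]) - 1‖ ≤ ‖v - 1‖ := by
  obtain ⟨F, hF, hFn⟩ := exists_continuousMap_eq_bpow hv
  rw [hF]
  refine PadicInt.denseRange_natCast.induction_on (p := fun t => ‖F t - 1‖ ≤ ‖v - 1‖) t
    (isClosed_le (by fun_prop) continuous_const) fun n => ?_
  rw [hFn]
  induction n with
  | zero => simp
  | succ n ih =>
    rw [show v ^ (n + 1) - 1 = (v ^ n - 1) * v + (v - 1) by ring]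
    refine (IsUltrametricDist.norm_add_le_max _ _).trans (max_le ?_ le_rfl)
    rwa [norm_mul, norm_eq_one_of_norm_sub_one_lt hv, mul_one]

theorem norm_bpow_le_one {v : ℚ_[p]} (hv : ‖v - 1‖ < 1) (t : ℤ_[p]) :
    ‖bpow p v (t : ℚ_[p])‖ ≤ 1 :=
  (norm_eq_one_of_norm_sub_one_lt ((norm_bpow_sub_one_le hv t).trans_lt hv)).le

theorem hasSum_bpow {v : ℚ_[p]} (hv : ‖v - 1‖ < 1) (t : ℤ_[p]) :
    HasSum (fun n : ℕ => gbinom p (t : ℚ_[p]) n * (v - 1) ^ n) (bpow p v (t : ℚ_[p])) := by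
  refine (Summable.of_norm_bounded (summable_geometric_of_lt_one (norm_nonneg _) hv)
    fun n => ?_).hasSum
  rw [norm_mul, norm_pow]
  exact mul_le_of_le_one_left (by positivity) (norm_gbinom_le_one t n)

theorem bpow_angle_add {x h : ℚ_[p]} (hx : ‖h‖ < ‖x‖) (t : ℤ_[p]) :
    bpow p (angle p (x + h)) (t : ℚ_[p]) =
      bpow p (angle p x) (t : ℚ_[p]) * bpow p (1 + h / x) (t : ℚ_[p]) := by
  have hx0 : x ≠ 0 := norm_pos_iff.1 ((norm_nonneg h).trans_lt hx)
  have hv : ‖1 + h / x - 1‖ < 1 := by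
    rwa [add_sub_cancel_left, norm_div, div_lt_one (norm_pos_iff.2 hx0)]
  rw [← bpow_mul (norm_angle_sub_one_lt hx0) hv, ← angle_mul_of_norm_sub_one_lt hx0 hv]
  congr 2
  field_simp

theorem continuousAt_bpow_angle {x : ℚ_[p]} (hx : x ≠ 0) (t : ℤ_[p]) :
    ContinuousAt (fun z => bpow p (angle p z) (t : ℚ_[p])) x := by
  have hx' := norm_pos_iff.2 hx
  rw [ContinuousAt, tendsto_iff_norm_sub_tendsto_zero]
  refine squeeze_zero' (Eventually.of_forall fun _ => norm_nonneg _)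
    (g := fun z => ‖(z - x) / x‖) ?_ ?_
  · filter_upwards [Metric.ball_mem_nhds x hx'] with z hz
    rw [Metric.mem_ball, dist_eq_norm] at hz
    have h := bpow_angle_add hz t
    rw [add_sub_cancel] at h
    have hv : ‖1 + (z - x) / x - 1‖ < 1 := by
      rwa [add_sub_cancel_left, norm_div, div_lt_one hx']
    have hle := norm_bpow_sub_one_le hv t
    rw [add_sub_cancel_left] at hle
    rw [h, ← mul_sub_one, norm_mul]
    exact (mul_le_of_le_one_left (norm_nonneg _)
      (norm_bpow_le_one (norm_angle_sub_one_lt hx) t)).trans hle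
  · have : ContinuousAt (fun z => ‖(z - x) / x‖) x := by fun_prop
    simpa [ContinuousAt] using this

theorem norm_fermSum_le {g : ℤ_[p] → ℚ_[p]} {C : ℝ} (hC : 0 ≤ C) (hg : ∀ a, ‖g a‖ ≤ C) (N : ℕ) :
    ‖fermSum p g N‖ ≤ C :=
  IsUltrametricDist.norm_sum_le_of_forall_le_of_nonneg hC fun a _ => by simpa using hg a

theorem fermSum_succ_sub (hp : Odd p) (g : ℤ_[p] → ℚ_[p]) (N : ℕ) :
    fermSum p g (N + 1) - fermSum p g N = ∑ j ∈ Finset.range p, ∑ a ∈ Finset.range (p ^ N),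
      (-1 : ℚ_[p]) ^ (a + p ^ N * j) * (g ((a + p ^ N * j : ℕ) : ℤ_[p]) - g (a : ℤ_[p])) := by
  have hsum : ∑ j ∈ Finset.range p, (-1 : ℚ_[p]) ^ (p ^ N * j) = 1 := by
    simp_rw [pow_mul, hp.pow.neg_one_pow]
    rw [neg_one_geom_sum, if_neg (Nat.not_even_iff_odd.2 hp)]
  have hsplit : fermSum p g (N + 1) = ∑ j ∈ Finset.range p, ∑ a ∈ Finset.range (p ^ N),
      (-1 : ℚ_[p]) ^ (a + p ^ N * j) * g ((a + p ^ N * j : ℕ) : ℤ_[p]) := by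
    have key (F : ℕ → ℚ_[p]) (m k : ℕ) : ∑ a ∈ Finset.range (m * k), F a =
        ∑ j ∈ Finset.range k, ∑ a ∈ Finset.range m, F (a + m * j) := by
      induction k with
      | zero => simp
      | succ k ih =>
        rw [mul_add_one, Finset.sum_range_add, ih, Finset.sum_range_succ]
        simp [add_comm]
    rw [fermSum, pow_succ]
    exact key (fun a => (-1 : ℚ_[p]) ^ a * g (a : ℤ_[p])) _ _
  simp_rw [mul_sub, Finset.sum_sub_distrib]
  rw [← hsplit]
  congr 1
  simp_rw [pow_add, mul_right_comm, ← Finset.sum_mul]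
  rw [← Finset.mul_sum, hsum, mul_one, fermSum]

theorem exists_tendsto_fermSum (hp : Odd p) {g : ℤ_[p] → ℚ_[p]} (hg : Continuous g) :
    ∃ L, Tendsto (fermSum p g) atTop (𝓝 L) := by
  have huc := CompactSpace.uniformContinuous_of_continuous hg
  refine cauchySeq_tendsto_of_complete (NonarchimedeanAddGroup.cauchySeq_of_tendsto_sub_nhds_zero ?_)
  rw [NormedAddGroup.tendsto_nhds_zero]
  intro ε hε
  obtain ⟨δ, hδ, h⟩ := Metric.uniformContinuous_iff.1 huc (ε / 2) (half_pos hε)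
  have hp1 : (p : ℝ)⁻¹ < 1 := inv_lt_one_of_one_lt₀ (mod_cast (Fact.out : p.Prime).one_lt)
  filter_upwards [(tendsto_pow_atTop_nhds_zero_of_lt_one (by positivity) hp1).eventually_lt_const hδ]
    with N hN
  rw [fermSum_succ_sub hp]
  refine lt_of_le_of_lt ?_ (half_lt_self hε)
  refine IsUltrametricDist.norm_sum_le_of_forall_le_of_nonneg (half_pos hε).le fun j _ =>
    IsUltrametricDist.norm_sum_le_of_forall_le_of_nonneg (half_pos hε).le fun a _ => ?_
  rw [norm_mul, norm_pow, norm_neg, norm_one, one_pow, one_mul, ← dist_eq_norm]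
  refine (h ?_).le
  rw [dist_eq_norm]
  push_cast
  rw [add_sub_cancel_left, norm_mul, norm_pow, PadicInt.norm_p]
  exact (mul_le_of_le_one_right (by positivity) (PadicInt.norm_le_one _)).trans_lt hN

theorem norm_add_coe_of_one_lt {y : ℚ_[p]} (hy : 1 < ‖y‖) (b : ℤ_[p]) :
    ‖y + (b : ℚ_[p])‖ = ‖y‖ := by
  have hb : ‖(b : ℚ_[p])‖ < ‖y‖ := (PadicInt.norm_le_one b).trans_lt hy
  rw [IsUltrametricDist.norm_add_eq_max_of_norm_ne_norm hb.ne', max_eq_left hb.le]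

end PZeta

open PZeta

/-- for an odd prime `p`, continuous `f`, `s ∈ ℤ_p` and `‖y‖ > 1`, there is a
power series `Σ c_n (λ-y)^n` converging for `‖λ-y‖ < ‖y‖` whose sum is the fermionic
integral `ζ_{p,E}^f(s,λ)`; i.e. `λ ↦ ζ_{p,E}^f(s,λ)` is analytic on that disc. -/
theorem zetaE_analytic_in_lam (p : ℕ) [Fact p.Prime] (hp : Odd p)
    (f : ℤ_[p] → ℤ_[p]) (hf : Continuous f) (s : ℤ_[p]) (y : ℚ_[p]) (hy : 1 < ‖y‖) :
    ∃ c : ℕ → ℚ_[p], ∀ lam : ℚ_[p], ‖lam - y‖ < ‖y‖ →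
      Summable (fun n : ℕ => c n * (lam - y) ^ n) ∧
      Filter.Tendsto
        (fermSum p fun a => bpow p (angle p (lam + (f a : ℚ_[p]))) (1 - (s : ℚ_[p])))
        Filter.atTop (nhds (∑' n : ℕ, c n * (lam - y) ^ n)) := by
  obtain ⟨t, ht⟩ : ∃ t : ℤ_[p], 1 - (s : ℚ_[p]) = t := ⟨1 - s, by push_cast; rfl⟩
  rw [ht]
  have hyf (a : ℤ_[p]) : ‖y + (f a : ℚ_[p])‖ = ‖y‖ := norm_add_coe_of_one_lt hy (f a)
  have hy0 : 0 < ‖y‖ := one_pos.trans hy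
  have hyf0 (a : ℤ_[p]) : y + (f a : ℚ_[p]) ≠ 0 := norm_pos_iff.1 (by rwa [hyf])
  let g (n : ℕ) (a : ℤ_[p]) : ℚ_[p] := bpow p (angle p (y + (f a : ℚ_[p]))) (t : ℚ_[p]) *
    (gbinom p (t : ℚ_[p]) n * (y + (f a : ℚ_[p]))⁻¹ ^ n)
  have hbase : Continuous fun a => y + (f a : ℚ_[p]) :=
    continuous_const.add (continuous_subtype_val.comp hf)
  have hgc (n : ℕ) : Continuous (g n) := by
    refine Continuous.mul (continuous_iff_continuousAt.2 fun a => ?_)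
      (continuous_const.mul ((hbase.inv₀ hyf0).pow n))
    exact ContinuousAt.comp (f := fun a => y + (f a : ℚ_[p]))
      (continuousAt_bpow_angle (hyf0 a) t) hbase.continuousAt
  have hgb (n : ℕ) (a : ℤ_[p]) : ‖g n a‖ ≤ ‖y‖⁻¹ ^ n := by
    rw [norm_mul, norm_mul, norm_pow, norm_inv, hyf]
    calc _ ≤ 1 * (1 * ‖y‖⁻¹ ^ n) := by
          gcongr
          · exact norm_bpow_le_one (norm_angle_sub_one_lt (hyf0 a)) t
          · exact norm_gbinom_le_one t n
      _ = _ := by ring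
  choose c hc using fun n => exists_tendsto_fermSum hp (hgc n)
  refine ⟨c, fun lam hlam => ?_⟩
  have hgeom : Summable fun n : ℕ => (‖lam - y‖ / ‖y‖) ^ n :=
    summable_geometric_of_lt_one (by positivity) ((div_lt_one hy0).2 hlam)
  have hterm {z : ℚ_[p]} {n : ℕ} (hz : ‖z‖ ≤ ‖y‖⁻¹ ^ n) :
      ‖z * (lam - y) ^ n‖ ≤ (‖lam - y‖ / ‖y‖) ^ n := by
    rw [norm_mul, norm_pow, div_eq_inv_mul, mul_pow]
    gcongr
  have hferm (N n : ℕ) : ‖fermSum p (g n) N‖ ≤ ‖y‖⁻¹ ^ n :=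
    norm_fermSum_le (by positivity) (hgb n) N
  have hexp (N : ℕ) :
      fermSum p (fun a => bpow p (angle p (lam + (f a : ℚ_[p]))) (t : ℚ_[p])) N =
        ∑' n : ℕ, fermSum p (g n) N * (lam - y) ^ n := by
    refine HasSum.tsum_eq ?_ |>.symm
    simp_rw [fermSum, Finset.sum_mul]
    refine hasSum_sum fun a _ => ?_
    have hlt : ‖lam - y‖ < ‖y + (f a : ℚ_[p])‖ := by rwa [hyf]
    have hv : ‖1 + (lam - y) / (y + (f a : ℚ_[p])) - 1‖ < 1 := by
      rwa [add_sub_cancel_left, norm_div, hyf, div_lt_one hy0]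
    rw [show lam + (f a : ℚ_[p]) = y + (f a : ℚ_[p]) + (lam - y) by ring, bpow_angle_add hlt]
    refine (((hasSum_bpow hv t).mul_left _).mul_left _).congr_fun fun n => ?_
    simp only [g, add_sub_cancel_left, div_eq_mul_inv, mul_pow]
    ring
  refine ⟨Summable.of_norm_bounded hgeom fun n => hterm ?_, ?_⟩
  · exact le_of_tendsto (hc n).norm (Eventually.of_forall fun N => hferm N n)
  · rw [funext hexp]
    exact tendsto_tsum_of_dominated_convergence hgeom (fun n => (hc n).mul_const _)
      (Eventually.of_forall fun N n => hterm (hferm N n))
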